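/- Let ℓ ≥ 1 and 1 ≤ N ≤ ℓ+2, and consider the M_ℓ model on the open chain of N sites with special boundary conditions s = (c₁, c_N) where 0 ≤ c₁, c_N ≤ min(ℓ, N−1). Then: (i) if c₁ = c_N = N−1 (possible only for 1 ≤ N ≤ ℓ+1), dim H_Q^f = 1 for f = N−1 and 0 for every other f, and the nontrivial class is represented by e_σ with σ = 01…1 (site 1 empty, sites 2,…,N occupied); (ii) if c₁ ≤ N−2, c_N ≤ N−2 and c₁ + c_N ≥ N−2 (so 2 ≤ N ≤ ℓ+2), dim H_Q^f = 1 for f = N−2 and 0 for every other f, and the nontrivial class is represented by e_σ with σ = 01…10 (sites 1 and N empty, the rest occupied); in all other such cases H_Q^f = 0 for every f. Moreover, in the unconstrained case where ℓ ≥ N and c₁ = c_N = ℓ (so that every configuration of the N sites is allowed), H_Q^f = 0 for every f. -/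

import Mathlib

attribute [local instance 10] Classical.propDecidable

noncomputable section

/-- A configuration of `N` sites: `true` = occupied, `false` = empty. -/
abbrev Config (N : ℕ) := Fin N → Bool

/-- Extension of a configuration to all of `ℕ`, by empty sites outside the chain. -/
def extc {N : ℕ} (σ : Config N) (t : ℕ) : Bool :=
  if h : t < N then σ ⟨t, h⟩ else false

/-- The fermion number: the number of occupied sites. -/
def fermions {N : ℕ} (σ : Config N) : ℕ :=
  (Finset.univ.filter fun i => σ i = true).card

/-- Allowed configurations of the open chain of `N` sites with exclusion parameter `ℓ`
and special boundary conditions `(c₁, cN)`: no cluster is longer than `ℓ`, the cluster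
containing the first site (if occupied) has length at most `c₁`, and the cluster
containing the last site (if occupied) has length at most `cN`. -/
def OpenOK (N ℓ c₁ cN : ℕ) (σ : Config N) : Prop :=
  (∀ a : ℕ, ¬ ∀ k ≤ ℓ, extc σ (a + k) = true) ∧
  (¬ (c₁ + 1 ≤ N ∧ ∀ k ≤ c₁, extc σ k = true)) ∧
  (¬ (cN + 1 ≤ N ∧ ∀ k ≤ cN, extc σ (N - 1 - k) = true))

/-- Cyclic shift of a site of the closed chain by `k` steps. -/
def cyc {N : ℕ} (i : Fin N) (k : ℕ) : Fin N :=
  ⟨(i.1 + k) % N, Nat.mod_lt _ i.pos⟩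

/-- Allowed configurations of the closed chain of `N` sites with periodic boundary
conditions: the chain is not fully occupied and no maximal cyclic run of occupied
sites is longer than `ℓ`. -/
def PerOK (N ℓ : ℕ) (σ : Config N) : Prop :=
  ∀ i : Fin N, ∃ k ≤ ℓ, σ (cyc i k) = false

/-- The fermionic sign `(-1)^{#{j < i : σ j = 1}}`. -/
def sgn {N : ℕ} (σ : Config N) (i : Fin N) : ℂ :=
  (-1 : ℂ) ^ ((Finset.univ.filter fun j => j < i ∧ σ j = true).card)

/-- The Hilbert space `V_N`: complex functions on allowed configurations. -/
abbrev AState (N : ℕ) (OK : Config N → Prop) := {σ : Config N // OK σ} → ℂ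

/-- Matrix of the supercharge with amplitudes `A`, with particle insertion
restricted to the sublattice `S`: the entry `(τ, σ)` is the amplitude (with fermionic
sign) for obtaining `τ` from `σ` by occupying an empty site of `S`. -/
def QmatA (N : ℕ) (OK : Config N → Prop) (S : Fin N → Prop)
    (A : Config N → Fin N → ℂ) :
    Matrix {σ : Config N // OK σ} {σ : Config N // OK σ} ℂ := fun τ σ =>
  ∑ i : Fin N,
    if S i ∧ σ.1 i = false ∧ τ.1 = Function.update σ.1 i true
    then A σ.1 i * sgn σ.1 i else 0

/-- The supercharge with amplitudes `A` restricted to the sublattice `S`, as a linear map. -/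
def QopA (N : ℕ) (OK : Config N → Prop) (S : Fin N → Prop)
    (A : Config N → Fin N → ℂ) : AState N OK →ₗ[ℂ] AState N OK :=
  (QmatA N OK S A).mulVecLin

/-- The unit-coupling supercharge restricted to the sublattice `S`. -/
def Qop (N : ℕ) (OK : Config N → Prop) (S : Fin N → Prop) :
    AState N OK →ₗ[ℂ] AState N OK :=
  QopA N OK S fun _ _ => 1

/-- The subspace `V_{N,f}` of states supported on configurations with fermion number `f`. -/
def gradeV (N : ℕ) (OK : Config N → Prop) (f : ℕ) :
    Submodule ℂ (AState N OK) where
  carrier := {ψ | ∀ σ, fermions σ.1 ≠ f → ψ σ = 0}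
  add_mem' := by
    intro a b ha hb σ h
    show a σ + b σ = 0
    rw [ha σ h, hb σ h, add_zero]
  zero_mem' := by intro σ h; rfl
  smul_mem' := by
    intro c a ha σ h
    show c * a σ = 0
    rw [ha σ h, mul_zero]

/-- The cocycles at gradeV `f`: `ker Q ∩ V_{N,f}` (for the supercharge restricted to `S`). -/
def cocycles (N : ℕ) (OK : Config N → Prop) (S : Fin N → Prop) (f : ℕ) :
    Submodule ℂ (AState N OK) :=
  LinearMap.ker (Qop N OK S) ⊓ gradeV N OK f

/-- The coboundaries at gradeV `f`: `Q (V_{N,f-1})` (for the supercharge restricted to `S`). -/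
def cobounds (N : ℕ) (OK : Config N → Prop) (S : Fin N → Prop) (f : ℕ) :
    Submodule ℂ (AState N OK) :=
  (gradeV N OK (f - 1)).map (Qop N OK S)

/-- The cohomology `H_Q^f = ker (Q : V_{N,f} → V_{N,f+1}) / Q (V_{N,f-1})`. -/
abbrev CohSpace (N : ℕ) (OK : Config N → Prop) (S : Fin N → Prop) (f : ℕ) :=
  cocycles N OK S f ⧸ ((cobounds N OK S f).comap (cocycles N OK S f).subtype)

/-- The dimension of `H_Q^f`. -/
def cohDim (N : ℕ) (OK : Config N → Prop) (S : Fin N → Prop) (f : ℕ) : ℕ :=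
  Module.finrank ℂ (CohSpace N OK S f)

/-- The cohomology class represented by a cocycle. -/
def cohClass (N : ℕ) (OK : Config N → Prop) (S : Fin N → Prop) (f : ℕ)
    (ψ : AState N OK) (h : ψ ∈ cocycles N OK S f) : CohSpace N OK S f :=
  Submodule.Quotient.mk ⟨ψ, h⟩

/-- The configuration `0 1 … 1` (site 1 empty, all other sites occupied). -/
def cfgA (N : ℕ) : Config N := fun i => decide (1 ≤ i.1)

/-- The configuration `0 1 … 1 0` (sites 1 and N empty, all other sites occupied). -/
def cfgB (N : ℕ) : Config N := fun i => decide (1 ≤ i.1 ∧ i.1 < N - 1)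

section FermionOperators

variable {N : ℕ}

theorem sgn_mul_self (σ : Config N) (i : Fin N) : sgn σ i * sgn σ i = 1 := by
  unfold sgn
  rw [← mul_pow]
  norm_num

theorem sgn_update_of_le (σ : Config N) {i j : Fin N} (h : i ≤ j) (b : Bool) :
    sgn (Function.update σ j b) i = sgn σ i := by
  unfold sgn
  congr 2
  ext k
  simp only [Finset.mem_filter, Finset.mem_univ, true_and]
  refine and_congr_right fun hk => ?_
  rw [Function.update_of_ne (hk.trans_le h).ne]

theorem sgn_update_of_lt (σ : Config N) {i j : Fin N} (h : j < i) :
    sgn (Function.update σ j true) i = -sgn (Function.update σ j false) i := by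
  unfold sgn
  have key : (Finset.univ.filter fun k => k < i ∧ Function.update σ j true k = true) =
      insert j (Finset.univ.filter fun k => k < i ∧ Function.update σ j false k = true) := by
    ext k
    by_cases hk : k = j
    · subst hk; simp [h]
    · simp [hk]
  rw [key, Finset.card_insert_of_notMem (by simp), pow_succ]
  ring

/-- Flipping the occupation of a site `j < i` reverses the fermionic sign at `i`. -/
theorem sgn_update_not (σ : Config N) {i j : Fin N} (h : j < i) {b : Bool} (hb : σ j = !b) :
    sgn (Function.update σ j b) i = -sgn σ i := by
  have h2 := sgn_update_of_lt σ h
  have h3 : sgn (Function.update σ j (!b)) i = sgn σ i := by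
    rw [← hb, Function.update_eq_self]
  cases b
  · simp only [Bool.not_false] at h3
    rw [← h3, h2, neg_neg]
  · simp only [Bool.not_true] at h3
    rw [← h3, h2]

theorem fermions_update_true (σ : Config N) {i : Fin N} (h : σ i = false) :
    fermions (Function.update σ i true) = fermions σ + 1 := by
  unfold fermions
  have key : (Finset.univ.filter fun k => Function.update σ i true k = true) =
      insert i (Finset.univ.filter fun k => σ k = true) := by
    ext k
    by_cases hk : k = i
    · subst hk; simp
    · simp [hk]
  rw [key, Finset.card_insert_of_notMem (by simp [h])]

/-- The fermion creation operator at site `i`, on functions on all configurations. -/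
def creation (i : Fin N) : (Config N → ℂ) →ₗ[ℂ] (Config N → ℂ) where
  toFun ψ τ := if τ i = true then sgn τ i * ψ (Function.update τ i false) else 0
  map_add' ψ φ := by
    ext τ
    simp only [Pi.add_apply]
    split_ifs <;> ring
  map_smul' c ψ := by
    ext τ
    simp only [Pi.smul_apply, smul_eq_mul, RingHom.id_apply]
    split_ifs <;> ring

/-- The fermion annihilation operator at site `i`, on functions on all configurations. -/
def annihilation (i : Fin N) : (Config N → ℂ) →ₗ[ℂ] (Config N → ℂ) where
  toFun ψ σ := if σ i = false then sgn σ i * ψ (Function.update σ i true) else 0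
  map_add' ψ φ := by
    ext τ
    simp only [Pi.add_apply]
    split_ifs <;> ring
  map_smul' c ψ := by
    ext τ
    simp only [Pi.smul_apply, smul_eq_mul, RingHom.id_apply]
    split_ifs <;> ring

theorem creation_apply (i : Fin N) (ψ : Config N → ℂ) (τ : Config N) :
    creation i ψ τ = if τ i = true then sgn τ i * ψ (Function.update τ i false) else 0 := rfl

theorem annihilation_apply (i : Fin N) (ψ : Config N → ℂ) (σ : Config N) :
    annihilation i ψ σ = if σ i = false then sgn σ i * ψ (Function.update σ i true) else 0 := rfl

theorem creation_anticomm (i j : Fin N) (ψ : Config N → ℂ) :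
    creation i (creation j ψ) = -creation j (creation i ψ) := by
  wlog hij : i ≤ j generalizing i j
  · rw [this j i (le_of_not_ge hij), neg_neg]
  ext τ
  rcases hij.eq_or_lt with rfl | hij
  · simp [creation_apply]
  · simp only [creation_apply, Pi.neg_apply, Function.update_of_ne hij.ne,
      Function.update_of_ne hij.ne']
    by_cases hi : τ i = true <;> by_cases hj : τ j = true <;> simp only [hi, hj, if_true,
      if_false, mul_zero, neg_zero, Bool.false_eq_true]
    rw [sgn_update_of_le τ hij.le, sgn_update_not τ hij (by simp [hi]),
      Function.update_comm hij.ne]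
    ring

theorem creation_annihilation_anticomm {i j : Fin N} (hij : i ≠ j) (ψ : Config N → ℂ) :
    creation i (annihilation j ψ) + annihilation j (creation i ψ) = 0 := by
  ext τ
  simp only [creation_apply, annihilation_apply, Pi.add_apply, Pi.zero_apply,
    Function.update_of_ne hij, Function.update_of_ne hij.symm]
  by_cases hi : τ i = true <;> by_cases hj : τ j = false <;> simp only [hi, hj, if_true,
    if_false, mul_zero, add_zero, Bool.false_eq_true, Bool.true_eq_false]
  rw [Function.update_comm hij]
  rcases lt_or_gt_of_ne hij with h | h
  · rw [sgn_update_of_le τ h.le, sgn_update_not τ h (by simp [hi])]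
    ring
  · rw [sgn_update_of_le τ h.le, sgn_update_not τ h (by simp [hj])]
    ring

theorem creation_annihilation_self (i : Fin N) (ψ : Config N → ℂ) :
    creation i (annihilation i ψ) + annihilation i (creation i ψ) = ψ := by
  ext τ
  simp only [creation_apply, annihilation_apply, Pi.add_apply, Function.update_self,
    sgn_update_of_le τ le_rfl, Function.update_idem, if_true, ← mul_assoc, sgn_mul_self, one_mul]
  by_cases hi : τ i = true
  · simp [hi, show Function.update τ i true = τ by rw [← hi, Function.update_eq_self]]
  · have hi : τ i = false := by simpa using hi
    simp [hi, show Function.update τ i false = τ by rw [← hi, Function.update_eq_self]]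

/-- The supercharge of the chain without exclusion rule. -/
def freeCharge (N : ℕ) : (Config N → ℂ) →ₗ[ℂ] (Config N → ℂ) := ∑ i, creation i

theorem freeCharge_apply (ψ : Config N → ℂ) : freeCharge N ψ = ∑ i, creation i ψ := by
  simp [freeCharge]

theorem freeCharge_freeCharge (ψ : Config N → ℂ) : freeCharge N (freeCharge N ψ) = 0 := by
  have h1 : freeCharge N (freeCharge N ψ) = ∑ i, ∑ j, creation i (creation j ψ) := by
    simp only [freeCharge_apply, map_sum]
    exact Finset.sum_comm
  have h2 : freeCharge N (freeCharge N ψ) = -freeCharge N (freeCharge N ψ) := by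
    conv_rhs => rw [h1, Finset.sum_comm]
    rw [h1, ← Finset.sum_neg_distrib]
    refine Finset.sum_congr rfl fun i _ => ?_
    rw [← Finset.sum_neg_distrib]
    exact Finset.sum_congr rfl fun j _ => creation_anticomm i j ψ
  exact self_eq_neg.mp h2

theorem freeCharge_annihilation (j : Fin N) (ψ : Config N → ℂ) :
    freeCharge N (annihilation j ψ) + annihilation j (freeCharge N ψ) = ψ := by
  rw [freeCharge_apply, freeCharge_apply, map_sum, ← Finset.sum_add_distrib,
    Finset.sum_eq_single j (fun i _ h => creation_annihilation_anticomm h ψ) (by simp),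
    creation_annihilation_self]

end FermionOperators

section RestrictedOperators

variable {N : ℕ} {OK : Config N → Prop}

/-- Extension of a state by zero to the configurations that are not allowed. -/
def extendZero (ψ : AState N OK) (σ : Config N) : ℂ := if h : OK σ then ψ ⟨σ, h⟩ else 0

theorem extendZero_of (ψ : AState N OK) {σ : Config N} (h : OK σ) :
    extendZero ψ σ = ψ ⟨σ, h⟩ := dif_pos h

theorem extendZero_of_not (ψ : AState N OK) {σ : Config N} (h : ¬ OK σ) :
    extendZero ψ σ = 0 := dif_neg h

theorem Qop_apply (ψ : AState N OK) (τ : {σ : Config N // OK σ}) :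
    Qop N OK (fun _ => True) ψ τ = freeCharge N (extendZero ψ) τ.1 := by
  simp only [Qop, QopA, Matrix.mulVecLin_apply, Matrix.mulVec, dotProduct, QmatA,
    Finset.sum_mul, true_and, one_mul]
  rw [Finset.sum_comm, freeCharge_apply, Finset.sum_apply]
  refine Finset.sum_congr rfl fun i _ => ?_
  have hid : ∀ σ : {σ : Config N // OK σ},
      σ.1 i = false → τ.1 = Function.update σ.1 i true →
        Function.update τ.1 i false = σ.1 := by
    intro σ h1 h2
    rw [h2, Function.update_idem, ← h1, Function.update_eq_self]
  rw [creation_apply]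
  by_cases hτ : τ.1 i = true
  · rw [if_pos hτ]
    have hback : τ.1 = Function.update (Function.update τ.1 i false) i true := by
      rw [Function.update_idem, ← hτ, Function.update_eq_self]
    by_cases hok : OK (Function.update τ.1 i false)
    · rw [extendZero_of ψ hok, Finset.sum_eq_single ⟨_, hok⟩]
      · rw [if_pos ⟨by simp, hback⟩, sgn_update_of_le _ le_rfl]
      · intro σ _ hσ
        rw [if_neg, zero_mul]
        rintro ⟨h1, h2⟩
        exact hσ (Subtype.ext (hid σ h1 h2).symm)
      · simp
    · rw [extendZero_of_not ψ hok, mul_zero]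
      refine Finset.sum_eq_zero fun σ _ => ?_
      rw [if_neg, zero_mul]
      rintro ⟨h1, h2⟩
      exact hok ((hid σ h1 h2).symm ▸ σ.2)
  · rw [if_neg hτ]
    refine Finset.sum_eq_zero fun σ _ => ?_
    rw [if_neg, zero_mul]
    rintro ⟨_, h2⟩
    exact hτ (by rw [h2, Function.update_self])

theorem Qop_mem_gradeV {ψ : AState N OK} {f : ℕ} (hψ : ψ ∈ gradeV N OK f) :
    Qop N OK (fun _ => True) ψ ∈ gradeV N OK (f + 1) := by
  intro τ hτ
  rw [Qop_apply, freeCharge_apply, Finset.sum_apply]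
  refine Finset.sum_eq_zero fun i _ => ?_
  rw [creation_apply]
  split_ifs with hi
  · by_cases hok : OK (Function.update τ.1 i false)
    · rw [extendZero_of ψ hok, hψ, mul_zero]
      have h := fermions_update_true (Function.update τ.1 i false) (i := i) (by simp)
      rw [Function.update_idem, ← hi, Function.update_eq_self] at h
      dsimp only
      omega
    · rw [extendZero_of_not ψ hok, mul_zero]
  · rfl

/-- The annihilation operator at site `i`, on states on allowed configurations. -/
def annihilate (OK : Config N → Prop) (i : Fin N) : AState N OK →ₗ[ℂ] AState N OK where
  toFun ψ σ := annihilation i (extendZero ψ) σ.1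
  map_add' ψ φ := by
    ext σ
    simp only [annihilation_apply, extendZero, Pi.add_apply]
    split_ifs <;> ring
  map_smul' c ψ := by
    ext σ
    simp only [annihilation_apply, extendZero, Pi.smul_apply, smul_eq_mul, RingHom.id_apply]
    split_ifs <;> ring

theorem annihilate_apply (i : Fin N) (ψ : AState N OK) (σ : {σ : Config N // OK σ}) :
    annihilate OK i ψ σ = annihilation i (extendZero ψ) σ.1 := rfl

theorem annihilate_of_mem_gradeV (i : Fin N) {ψ : AState N OK} {f : ℕ}
    (hψ : ψ ∈ gradeV N OK f) (σ : {σ : Config N // OK σ}) (hσ : fermions σ.1 + 1 ≠ f) :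
    annihilate OK i ψ σ = 0 := by
  rw [annihilate_apply, annihilation_apply]
  split_ifs with hi
  · by_cases hok : OK (Function.update σ.1 i true)
    · rw [extendZero_of ψ hok, hψ, mul_zero]
      rwa [fermions_update_true _ hi]
    · rw [extendZero_of_not ψ hok, mul_zero]
  · rfl

/-- The obstruction to `annihilate OK i` being a contracting homotopy: it is supported on
configurations which become forbidden when site `i` is occupied. -/
def obstruction (OK : Config N → Prop) (i : Fin N) (ψ : AState N OK) : AState N OK := fun σ =>
  if σ.1 i = false ∧ ¬ OK (Function.update σ.1 i true) then
    sgn σ.1 i * freeCharge N (extendZero ψ) (Function.update σ.1 i true) else 0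

theorem of_obstruction_ne_zero {i : Fin N} {ψ : AState N OK} {σ : {σ : Config N // OK σ}}
    (h : obstruction OK i ψ σ ≠ 0) :
    σ.1 i = false ∧ ¬ OK (Function.update σ.1 i true) ∧
      ∃ k, Function.update σ.1 i true k = true ∧
        ∃ hok : OK (Function.update (Function.update σ.1 i true) k false),
          ψ ⟨Function.update (Function.update σ.1 i true) k false, hok⟩ ≠ 0 := by
  unfold obstruction at h
  split_ifs at h with hi
  · refine ⟨hi.1, hi.2, ?_⟩
    have h2 := right_ne_zero_of_mul h
    rw [freeCharge_apply, Finset.sum_apply] at h2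
    obtain ⟨k, _, hk⟩ := Finset.exists_ne_zero_of_sum_ne_zero h2
    rw [creation_apply] at hk
    split_ifs at hk with hk1
    · have hk2 := right_ne_zero_of_mul hk
      unfold extendZero at hk2
      split_ifs at hk2 with hok
      · exact ⟨k, hk1, hok, hk2⟩
      · exact absurd rfl hk2
    · exact absurd rfl hk
  · exact absurd rfl h

theorem annihilate_single {i : Fin N} {A : {σ : Config N // OK σ}} (hA : A.1 i = false) :
    annihilate OK i (Pi.single A 1) = 0 := by
  ext σ
  rw [annihilate_apply, annihilation_apply]
  split_ifs with hi
  · by_cases hok : OK (Function.update σ.1 i true)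
    · rw [extendZero_of _ hok, Pi.single_eq_of_ne, mul_zero, Pi.zero_apply]
      rintro rfl
      simp at hA
    · rw [extendZero_of_not _ hok, mul_zero, Pi.zero_apply]
  · rfl

theorem Qop_single {A : {σ : Config N // OK σ}}
    (hA : ∀ k, A.1 k = false → ¬ OK (Function.update A.1 k true)) :
    Qop N OK (fun _ => True) (Pi.single A 1) = 0 := by
  ext τ
  rw [Qop_apply, freeCharge_apply, Finset.sum_apply]
  refine Finset.sum_eq_zero fun i _ => ?_
  rw [creation_apply]
  split_ifs with hi
  · by_cases hok : OK (Function.update τ.1 i false)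
    · rw [extendZero_of _ hok, Pi.single_eq_of_ne, mul_zero]
      rintro rfl
      refine hA i (by simp) ?_
      dsimp only
      rw [Function.update_idem, ← hi, Function.update_eq_self]
      exact τ.2
    · rw [extendZero_of_not _ hok, mul_zero]
  · rfl

theorem update_false_of_update {σ : Config N} {i : Fin N}
    (hd : ∀ σ i, OK σ → OK (Function.update σ i false))
    (hi : σ i = false) (h : OK (Function.update σ i true)) : OK σ := by
  have := hd _ i h
  rwa [Function.update_idem, ← hi, Function.update_eq_self] at this

theorem extendZero_annihilate (hd : ∀ σ i, OK σ → OK (Function.update σ i false))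
    (i : Fin N) (ψ : AState N OK) :
    extendZero (annihilate OK i ψ) = annihilation i (extendZero ψ) := by
  ext σ
  by_cases hok : OK σ
  · rw [extendZero_of _ hok, annihilate_apply]
  · rw [extendZero_of_not _ hok, annihilation_apply]
    split_ifs with hi
    · rw [extendZero_of_not, mul_zero]
      exact fun h => hok (update_false_of_update hd hi h)
    · rfl

theorem annihilate_homotopy (hd : ∀ σ i, OK σ → OK (Function.update σ i false))
    (i : Fin N) (ψ : AState N OK) :
    ψ - Qop N OK (fun _ => True) (annihilate OK i ψ) -
      annihilate OK i (Qop N OK (fun _ => True) ψ) = obstruction OK i ψ := by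
  ext σ
  have key := congrFun (freeCharge_annihilation i (extendZero ψ)) σ.1
  rw [extendZero_of ψ σ.2, Pi.add_apply, ← extendZero_annihilate hd, ← Qop_apply] at key
  rw [Pi.sub_apply, Pi.sub_apply, annihilate_apply, ← key, add_sub_cancel_left]
  unfold obstruction
  rw [annihilation_apply, annihilation_apply]
  by_cases hi : σ.1 i = false
  · by_cases hok : OK (Function.update σ.1 i true)
    · simp [hi, hok, extendZero_of _ hok, Qop_apply]
    · simp [hi, hok, extendZero_of_not _ hok]
  · simp [hi]

theorem Qop_Qop (hd : ∀ σ i, OK σ → OK (Function.update σ i false)) (ψ : AState N OK) :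
    Qop N OK (fun _ => True) (Qop N OK (fun _ => True) ψ) = 0 := by
  ext τ
  have key := congrFun (freeCharge_freeCharge (extendZero ψ)) τ.1
  rw [Pi.zero_apply] at key ⊢
  rw [Qop_apply, ← key, freeCharge_apply, freeCharge_apply (freeCharge N _),
    Finset.sum_apply, Finset.sum_apply]
  refine Finset.sum_congr rfl fun i _ => ?_
  rw [creation_apply, creation_apply]
  split_ifs with hi
  · rw [extendZero_of _ (hd _ i τ.2), Qop_apply]
  · rfl

end RestrictedOperators

section Cohomology

variable {N : ℕ} {OK : Config N → Prop}

theorem mem_cobounds_of_homotopy {K : AState N OK →ₗ[ℂ] AState N OK}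
    (hK : ∀ f, ∀ ψ ∈ gradeV N OK f, ∀ σ, fermions σ.1 + 1 ≠ f → K ψ σ = 0)
    {f : ℕ} {ψ : AState N OK} (hψ : ψ ∈ gradeV N OK f) :
    Qop N OK (fun _ => True) (K ψ) ∈ cobounds N OK (fun _ => True) f := by
  refine Submodule.mem_map_of_mem fun σ hσ => hK f ψ hψ σ ?_
  omega

theorem Qop_homotopy_mem_gradeV {K : AState N OK →ₗ[ℂ] AState N OK}
    (hK : ∀ f, ∀ ψ ∈ gradeV N OK f, ∀ σ, fermions σ.1 + 1 ≠ f → K ψ σ = 0)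
    {f : ℕ} {ψ : AState N OK} (hψ : ψ ∈ gradeV N OK f) :
    Qop N OK (fun _ => True) (K ψ) ∈ gradeV N OK f := by
  cases f with
  | zero =>
    have : K ψ = 0 := by
      ext σ
      exact hK 0 ψ hψ σ (by omega)
    rw [this, map_zero]
    exact zero_mem _
  | succ f => exact Qop_mem_gradeV fun σ hσ => hK _ ψ hψ σ (by omega)

theorem cohDim_eq_zero_of_le {f : ℕ}
    (h : cocycles N OK (fun _ => True) f ≤ cobounds N OK (fun _ => True) f) :
    cohDim N OK (fun _ => True) f = 0 := by
  have : Subsingleton (CohSpace N OK (fun _ => True) f) := by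
    rw [Submodule.Quotient.subsingleton_iff, Submodule.comap_subtype_eq_top]
    exact h
  exact Module.finrank_zero_of_subsingleton

/-- If occupying site `i` is always allowed then the cohomology vanishes. -/
theorem cohDim_eq_zero_of_cone (hd : ∀ σ i, OK σ → OK (Function.update σ i false))
    (i : Fin N) (hi : ∀ σ, OK σ → OK (Function.update σ i true)) (f : ℕ) :
    cohDim N OK (fun _ => True) f = 0 := by
  refine cohDim_eq_zero_of_le fun ψ hψ => ?_
  have h1 := annihilate_homotopy hd i ψ
  have h2 : obstruction OK i ψ = 0 := by
    ext σ
    exact if_neg fun h => h.2 (hi _ σ.2)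
  rw [LinearMap.mem_ker.mp hψ.1, map_zero, sub_zero, h2, sub_eq_zero] at h1
  rw [h1]
  exact mem_cobounds_of_homotopy (fun f ψ hψ => annihilate_of_mem_gradeV i hψ) hψ.2

/-- A homotopy `K` which contracts the complex onto the span of the configuration `A`
computes the cohomology. -/
theorem cohomology_of_homotopy (hQ : ∀ ψ : AState N OK,
      Qop N OK (fun _ => True) (Qop N OK (fun _ => True) ψ) = 0)
    (K : AState N OK →ₗ[ℂ] AState N OK)
    (hK : ∀ f, ∀ ψ ∈ gradeV N OK f, ∀ σ, fermions σ.1 + 1 ≠ f → K ψ σ = 0)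
    (A : {σ : Config N // OK σ}) {n : ℕ} (hn : fermions A.1 = n)
    (hQA : Qop N OK (fun _ => True) (Pi.single A 1) = 0) (hKA : K (Pi.single A 1) = 0)
    (hP : ∀ ψ σ, σ ≠ A →
      (ψ - Qop N OK (fun _ => True) (K ψ) - K (Qop N OK (fun _ => True) ψ)) σ = 0) :
    (∀ f, cohDim N OK (fun _ => True) f = if f = n then 1 else 0) ∧
      ∃ hc : Pi.single A (1 : ℂ) ∈ cocycles N OK (fun _ => True) n,
        cohClass N OK (fun _ => True) n _ hc ≠ 0 := by
  have hspan : ∀ ψ : AState N OK,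
      ψ - Qop N OK (fun _ => True) (K ψ) - K (Qop N OK (fun _ => True) ψ) =
      (ψ - Qop N OK (fun _ => True) (K ψ) - K (Qop N OK (fun _ => True) ψ)) A •
        (Pi.single A (1 : ℂ) : AState N OK) := by
    intro ψ
    ext σ
    by_cases h : σ = A
    · subst h; simp
    · rw [hP ψ σ h]; simp [h]
  have hc : Pi.single A (1 : ℂ) ∈ cocycles N OK (fun _ => True) n := by
    refine ⟨hQA, fun σ hσ => Pi.single_eq_of_ne ?_ _⟩
    rintro rfl
    exact hσ hn
  have hne : cohClass N OK (fun _ => True) n _ hc ≠ 0 := by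
    intro h0
    rw [cohClass, Submodule.Quotient.mk_eq_zero] at h0
    obtain ⟨φ, -, hφ⟩ := h0
    simp only [Submodule.subtype_apply] at hφ
    have h1 := congrArg (Qop N OK (fun _ => True)) (hspan φ)
    rw [map_smul, hQA, smul_zero, map_sub, map_sub, hQ, sub_zero, hφ, hKA, map_zero,
      sub_zero] at h1
    have h3 := congrFun h1 A
    simp at h3
  refine ⟨fun f => ?_, hc, hne⟩
  split_ifs with hf
  · subst hf
    refine finrank_eq_one_iff'.mpr ⟨_, hne, fun w => ?_⟩
    obtain ⟨⟨ψ, hψ⟩, rfl⟩ := Submodule.Quotient.mk_surjective _ w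
    have h1 := hspan ψ
    rw [LinearMap.mem_ker.mp hψ.1, map_zero, sub_zero] at h1
    refine ⟨(ψ - Qop N OK (fun _ => True) (K ψ)) A, ?_⟩
    rw [cohClass, ← Submodule.Quotient.mk_smul, eq_comm, Submodule.Quotient.eq]
    change ψ - _ • (Pi.single A (1 : ℂ) : AState N OK) ∈ cobounds N OK (fun _ => True) f
    rw [← h1, sub_sub_cancel]
    exact mem_cobounds_of_homotopy hK hψ.2
  · refine cohDim_eq_zero_of_le fun ψ hψ => ?_
    have h1 := hspan ψ
    have hA : fermions A.1 ≠ f := by omega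
    rw [LinearMap.mem_ker.mp hψ.1, map_zero, sub_zero, Pi.sub_apply, hψ.2 A hA,
      Qop_homotopy_mem_gradeV hK hψ.2 A hA, sub_zero, zero_smul, sub_eq_zero] at h1
    rw [h1]
    exact mem_cobounds_of_homotopy hK hψ.2

/-- If matching configurations first along site `i` and then along site `j` leaves only
the configuration `A`, then the cohomology is spanned by the class of `A`. -/
theorem cohomology_of_matching (hd : ∀ σ i, OK σ → OK (Function.update σ i false))
    (i j : Fin N) (A : {σ : Config N // OK σ}) {n : ℕ} (hn : fermions A.1 = n)
    (hi : A.1 i = false) (hj : A.1 j = false)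
    (hmax : ∀ k, A.1 k = false → ¬ OK (Function.update A.1 k true))
    (hcrit : ∀ σ k, OK σ → σ j = false → ¬ OK (Function.update σ j true) →
      OK (Function.update (Function.update σ j true) k false) →
      Function.update (Function.update σ j true) k false i = false →
      ¬ OK (Function.update (Function.update (Function.update σ j true) k false) i true) →
      σ = A.1) :
    (∀ f, cohDim N OK (fun _ => True) f = if f = n then 1 else 0) ∧
      ∃ hc : Pi.single A (1 : ℂ) ∈ cocycles N OK (fun _ => True) n,
        cohClass N OK (fun _ => True) n _ hc ≠ 0 := by
  let Q := Qop N OK fun _ => True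
  let a := annihilate OK i
  let b := annihilate OK j
  have hQ : ∀ ψ, Q (Q ψ) = 0 := Qop_Qop hd
  have ha : ∀ f, ∀ ψ ∈ gradeV N OK f, ∀ σ, fermions σ.1 + 1 ≠ f → a ψ σ = 0 :=
    fun f ψ hψ => annihilate_of_mem_gradeV i hψ
  have hb : ∀ f, ∀ ψ ∈ gradeV N OK f, ∀ σ, fermions σ.1 + 1 ≠ f → b ψ σ = 0 :=
    fun f ψ hψ => annihilate_of_mem_gradeV j hψ
  have hoa : ∀ ψ, ψ - Q (a ψ) - a (Q ψ) = obstruction OK i ψ := annihilate_homotopy hd i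
  have hob : ∀ ψ, ψ - Q (b ψ) - b (Q ψ) = obstruction OK j ψ := annihilate_homotopy hd j
  have haA : a (Pi.single A (1 : ℂ)) = 0 := annihilate_single hi
  have hbA : b (Pi.single A (1 : ℂ)) = 0 := annihilate_single hj
  refine cohomology_of_homotopy hQ (b + a - Q ∘ₗ b ∘ₗ a - b ∘ₗ Q ∘ₗ a) ?_ A hn
    (Qop_single hmax) (by simp [haA, hbA]) ?_
  · intro f ψ hψ σ hσ
    have h1 := hb f ψ hψ σ hσ
    have h2 := ha f ψ hψ σ hσ
    have h3 : Q (b (a ψ)) σ = 0 := by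
      have : a ψ ∈ gradeV N OK (f - 1) := fun σ hσ => ha f ψ hψ σ (by omega)
      cases f with
      | zero =>
        have h0 : a ψ = 0 := by
          ext σ
          exact ha 0 ψ hψ σ (by omega)
        rw [h0, map_zero, map_zero, Pi.zero_apply]
      | succ f => exact Qop_homotopy_mem_gradeV hb this σ (by omega)
    have h4 : b (Q (a ψ)) σ = 0 := hb f _ (Qop_homotopy_mem_gradeV ha hψ) σ hσ
    simp [h1, h2, h3, h4]
  · intro ψ σ hσ
    by_contra hne
    have hcomp : ψ - Q ((b + a - Q ∘ₗ b ∘ₗ a - b ∘ₗ Q ∘ₗ a) ψ) -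
        (b + a - Q ∘ₗ b ∘ₗ a - b ∘ₗ Q ∘ₗ a) (Q ψ) =
        obstruction OK j (obstruction OK i ψ) := by
      rw [← hob, ← hoa]
      simp only [LinearMap.sub_apply, LinearMap.add_apply, LinearMap.comp_apply, map_sub,
        map_add, hQ, map_zero]
      abel
    change (ψ - Q ((b + a - Q ∘ₗ b ∘ₗ a - b ∘ₗ Q ∘ₗ a) ψ) -
        (b + a - Q ∘ₗ b ∘ₗ a - b ∘ₗ Q ∘ₗ a) (Q ψ)) σ ≠ 0 at hne
    rw [hcomp] at hne
    obtain ⟨h1, h2, k, -, hok, hk⟩ := of_obstruction_ne_zero hne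
    obtain ⟨h3, h4, -⟩ := of_obstruction_ne_zero hk
    exact hσ (Subtype.ext (hcrit σ.1 k σ.2 h1 h2 hok h3 h4))

end Cohomology

section Chain

variable {N ℓ c₁ cN : ℕ}

theorem extc_update_false {σ : Config N} {i : Fin N} {t : ℕ}
    (h : extc (Function.update σ i false) t = true) : extc σ t = true := by
  unfold extc at h ⊢
  split_ifs at h ⊢ with ht
  by_cases hi : (⟨t, ht⟩ : Fin N) = i
  · subst hi; simp at h
  · rwa [Function.update_of_ne hi] at h

theorem OpenOK.update_false (σ : Config N) (i : Fin N) (h : OpenOK N ℓ c₁ cN σ) :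
    OpenOK N ℓ c₁ cN (Function.update σ i false) :=
  ⟨fun a ha => h.1 a fun k hk => extc_update_false (ha k hk),
    fun ha => h.2.1 ⟨ha.1, fun k hk => extc_update_false (ha.2 k hk)⟩,
    fun ha => h.2.2 ⟨ha.1, fun k hk => extc_update_false (ha.2 k hk)⟩⟩

theorem lt_of_extc {σ : Config N} {t : ℕ} (h : extc σ t = true) : t < N := by
  unfold extc at h
  split_ifs at h with ht
  exact ht

theorem extc_val (σ : Config N) (t : Fin N) : extc σ t = σ t := by
  simp [extc]

/-- On a short chain only the two boundary conditions constrain the configurations. -/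
theorem openOK_iff (hN1 : 1 ≤ N) (hN2 : N ≤ ℓ + 2) (h₁ : c₁ ≤ ℓ) (h₂ : cN ≤ ℓ)
    (h₁' : c₁ ≤ N - 1) (h₂' : cN ≤ N - 1) (σ : Config N) :
    OpenOK N ℓ c₁ cN σ ↔
      (∃ t : Fin N, t.1 ≤ c₁ ∧ σ t = false) ∧ ∃ t : Fin N, N - 1 ≤ t.1 + cN ∧ σ t = false := by
  constructor
  · rintro ⟨-, hl, hr⟩
    constructor
    · by_contra! h
      refine hl ⟨by omega, fun k hk => ?_⟩
      have := h ⟨k, by omega⟩ hk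
      rw [← extc_val σ] at this
      simpa using this
    · by_contra! h
      refine hr ⟨by omega, fun k hk => ?_⟩
      have := h ⟨N - 1 - k, by omega⟩ (by simp only; omega)
      rw [← extc_val σ] at this
      simpa using this
  · rintro ⟨⟨s, hs, hs'⟩, t, ht, ht'⟩
    rw [← extc_val σ] at hs' ht'
    refine ⟨fun a ha => ?_, fun h => ?_, fun h => ?_⟩
    · have hlt := lt_of_extc (ha ℓ le_rfl)
      obtain rfl | rfl : a = 0 ∨ a = 1 := by omega
      · have := ha s (by omega)
        simp [hs'] at this
      · have := ha (t - 1) (by omega)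
        rw [show 1 + (t.1 - 1) = t.1 by omega, ht'] at this
        simp at this
    · have := h.2 s hs
      simp [hs'] at this
    · have := h.2 (N - 1 - t) (by omega)
      rw [show N - 1 - (N - 1 - t.1) = t.1 by omega, ht'] at this
      simp at this

theorem openOK_of_le (hN : N ≤ ℓ) (σ : Config N) : OpenOK N ℓ ℓ ℓ σ := by
  refine ⟨fun a ha => ?_, fun h => ?_, fun h => ?_⟩
  · have := lt_of_extc (ha ℓ le_rfl)
    omega
  · omega
  · omega

theorem fermions_cfgA (hN : 1 ≤ N) : fermions (cfgA N) = N - 1 := by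
  unfold fermions cfgA
  rw [show (Finset.univ.filter fun i : Fin N => decide (1 ≤ i.1) = true) =
    Finset.univ.erase ⟨0, hN⟩ by ext i; simp [Fin.ext_iff]; omega]
  simp

theorem fermions_cfgB (hN : 2 ≤ N) : fermions (cfgB N) = N - 2 := by
  unfold fermions cfgB
  rw [show (Finset.univ.filter fun i : Fin N => decide (1 ≤ i.1 ∧ i.1 < N - 1) = true) =
    (Finset.univ.erase ⟨0, by omega⟩).erase ⟨N - 1, by omega⟩ by
      ext i; simp [Fin.ext_iff]; omega]
  rw [Finset.card_erase_of_mem (by simp [Fin.ext_iff]; omega)]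
  simp
  omega

end Chain

/-- Cohomology of short open chains `1 ≤ N ≤ ℓ+2` with special boundary conditions
`(c₁, cN)`, `0 ≤ c₁, cN ≤ min(ℓ, N-1)`:
(i) if `c₁ = cN = N-1` (so `N ≤ ℓ+1`), the cohomology is one-dimensional,
concentrated at fermion number `N-1`, with nontrivial class represented by `0 1…1`;
(ii) if `c₁, cN ≤ N-2` and `c₁ + cN ≥ N-2` (so `2 ≤ N`), it is one-dimensional,
concentrated at fermion number `N-2`, with nontrivial class represented by `0 1…1 0`;
otherwise it vanishes. Moreover, in the unconstrained case `ℓ ≥ N`, `c₁ = cN = ℓ`,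
the cohomology vanishes identically. -/
theorem cohomology_special_short_chain (ℓ N c₁ cN : ℕ) (hℓ : 1 ≤ ℓ)
    (hN1 : 1 ≤ N) (hN2 : N ≤ ℓ + 2) :
    (c₁ = N - 1 → cN = N - 1 → N ≤ ℓ + 1 →
      (∀ f, cohDim N (OpenOK N ℓ c₁ cN) (fun _ => True) f =
        if f = N - 1 then 1 else 0) ∧
      ∃ (hok : OpenOK N ℓ c₁ cN (cfgA N))
        (hc : Pi.single (⟨cfgA N, hok⟩ : {σ : Config N // OpenOK N ℓ c₁ cN σ}) (1 : ℂ) ∈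
          cocycles N (OpenOK N ℓ c₁ cN) (fun _ => True) (N - 1)),
        cohClass N (OpenOK N ℓ c₁ cN) (fun _ => True) (N - 1) _ hc ≠ 0) ∧
    (2 ≤ N → c₁ ≤ N - 2 → cN ≤ N - 2 → N - 2 ≤ c₁ + cN →
      (∀ f, cohDim N (OpenOK N ℓ c₁ cN) (fun _ => True) f =
        if f = N - 2 then 1 else 0) ∧
      ∃ (hok : OpenOK N ℓ c₁ cN (cfgB N))
        (hc : Pi.single (⟨cfgB N, hok⟩ : {σ : Config N // OpenOK N ℓ c₁ cN σ}) (1 : ℂ) ∈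
          cocycles N (OpenOK N ℓ c₁ cN) (fun _ => True) (N - 2)),
        cohClass N (OpenOK N ℓ c₁ cN) (fun _ => True) (N - 2) _ hc ≠ 0) ∧
    (c₁ ≤ min ℓ (N - 1) → cN ≤ min ℓ (N - 1) →
      ¬ (c₁ = N - 1 ∧ cN = N - 1) →
      ¬ (2 ≤ N ∧ c₁ ≤ N - 2 ∧ cN ≤ N - 2 ∧ N - 2 ≤ c₁ + cN) →
      ∀ f, cohDim N (OpenOK N ℓ c₁ cN) (fun _ => True) f = 0) ∧
    (N ≤ ℓ → ∀ f, cohDim N (OpenOK N ℓ ℓ ℓ) (fun _ => True) f = 0) := by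
  have hd (c c' : ℕ) := OpenOK.update_false (N := N) (ℓ := ℓ) (c₁ := c) (cN := c')
  refine ⟨?_, ?_, ?_, ?_⟩
  · rintro rfl rfl hN
    have hiff (σ : Config N) : OpenOK N ℓ (N - 1) (N - 1) σ ↔ ∃ t, σ t = false := by
      rw [openOK_iff hN1 hN2 (by omega) (by omega) le_rfl le_rfl]
      constructor
      · rintro ⟨⟨t, -, ht⟩, -⟩
        exact ⟨t, ht⟩
      · rintro ⟨t, ht⟩
        exact ⟨⟨t, by omega, ht⟩, t, by omega, ht⟩
    have hA (k : Fin N) : cfgA N k = false ↔ k = ⟨0, hN1⟩ := by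
      simp [cfgA, Fin.ext_iff]
    have hok : OpenOK N ℓ (N - 1) (N - 1) (cfgA N) := (hiff _).2 ⟨_, (hA _).2 rfl⟩
    refine And.imp_right (fun h => ⟨hok, h⟩) <|
      cohomology_of_matching (hd _ _) ⟨0, hN1⟩ ⟨0, hN1⟩ ⟨_, hok⟩
      (fermions_cfgA hN1) ((hA _).2 rfl) ((hA _).2 rfl) ?_ ?_
    · intro k hk h
      obtain ⟨t, ht⟩ := (hiff _).1 h
      rw [hA] at hk
      subst hk
      by_cases h0 : t = ⟨0, hN1⟩
      · subst h0; simp at ht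
      · rw [Function.update_of_ne h0, hA] at ht
        exact h0 ht
    · intro σ _ _ h0 h _ _ _
      ext t
      dsimp only
      simp only [hiff, not_exists, Bool.not_eq_false] at h
      by_cases ht : t = ⟨0, hN1⟩
      · subst ht
        rw [h0, (hA _).2 rfl]
      · have h3 := h t
        rw [Function.update_of_ne ht] at h3
        have h4 := (hA t).not.2 ht
        rw [h3, Bool.eq_true_of_not_eq_false h4]
  · intro hN h₁ h₂ h₁₂
    have hiff := openOK_iff (N := N) (ℓ := ℓ) (c₁ := c₁) (cN := cN) hN1 hN2 (by omega)
      (by omega) (by omega) (by omega)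
    have hB (k : Fin N) : cfgB N k = false ↔ k.1 = 0 ∨ k.1 = N - 1 := by
      simp [cfgB]
      omega
    have hok : OpenOK N ℓ c₁ cN (cfgB N) := (hiff _).2
      ⟨⟨⟨0, hN1⟩, by simp, by simp [hB]⟩, ⟨⟨N - 1, by omega⟩, by simp, by simp [hB]⟩⟩
    refine And.imp_right (fun h => ⟨hok, h⟩) <|
      cohomology_of_matching (hd _ _) ⟨0, hN1⟩ ⟨N - 1, by omega⟩ ⟨_, hok⟩
      (fermions_cfgB hN) (by simp [hB]) (by simp [hB]) ?_ ?_
    · intro k hk h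
      obtain ⟨⟨s, hs, hs'⟩, t, ht, ht'⟩ := (hiff _).1 h
      simp only [Function.update_apply, hB, Fin.ext_iff] at hk hs' ht'
      split_ifs at hs' ht'
      simp only [hB] at hs' ht'
      omega
    · intro σ k hσ hσN hσN' hρ hρ0 hρ0'
      obtain ⟨⟨s, hs, hs'⟩, -⟩ := (hiff _).1 hσ
      obtain ⟨-, u, hu, hu'⟩ := (hiff _).1 hρ
      have hright (t : Fin N) (ht : N - 1 ≤ t.1 + cN) (htN : t.1 ≠ N - 1) : σ t = true := by
        by_contra hf
        refine hσN' ((hiff _).2 ⟨⟨s, hs, ?_⟩, t, ht, ?_⟩)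
        · rwa [Function.update_of_ne (by simp only [ne_eq, Fin.ext_iff]; omega)]
        · rw [Function.update_of_ne (by simpa only [ne_eq, Fin.ext_iff] using htN)]
          simpa using hf
      have hleft (t : Fin N) (ht : t.1 ≤ c₁) (ht0 : t.1 ≠ 0) : σ t = true := by
        by_contra hf
        refine hρ0' ((hiff _).2 ⟨⟨t, ht, ?_⟩, u, hu, ?_⟩)
        · rw [Function.update_of_ne (by simpa only [ne_eq, Fin.ext_iff] using ht0)]
          by_cases htk : t = k
          · rw [htk, Function.update_self]
          · rw [Function.update_of_ne htk,
              Function.update_of_ne (by simp only [ne_eq, Fin.ext_iff]; omega)]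
            simpa using hf
        · rwa [Function.update_of_ne (by simp only [ne_eq, Fin.ext_iff]; omega)]
      ext t
      dsimp only
      by_cases ht : t.1 = 0 ∨ t.1 = N - 1
      · rw [(hB t).2 ht]
        rcases ht with ht | ht
        · have hs0 : s.1 = 0 := by
            by_contra h0
            simp [hleft s hs h0] at hs'
          rwa [show t = s from Fin.ext (ht.trans hs0.symm)]
        · rwa [show t = ⟨N - 1, by omega⟩ from Fin.ext ht]
      · have hBt := (hB t).not.2 ht
        rw [Bool.not_eq_false] at hBt
        rw [hBt]
        push Not at ht
        by_cases htc : t.1 ≤ c₁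
        · exact hleft t htc ht.1
        · exact hright t (by omega) ht.2
  · intro h₁ h₂ hne hne'
    have hiff := openOK_iff (N := N) (ℓ := ℓ) (c₁ := c₁) (cN := cN) hN1 hN2 (by omega)
      (by omega) (by omega) (by omega)
    have hcone (i : Fin N) (hi : (c₁ < i.1 ∨ c₁ = N - 1) ∧ (i.1 + cN < N - 1 ∨ cN = N - 1)) :
        ∀ f, cohDim N (OpenOK N ℓ c₁ cN) (fun _ => True) f = 0 := by
      refine cohDim_eq_zero_of_cone (hd _ _) i fun σ hσ => ?_
      rw [hiff] at hσ ⊢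
      obtain ⟨⟨s, hs, hs'⟩, t, ht, ht'⟩ := hσ
      have upd (u : Fin N) (hu : σ u = false) (hui : u.1 ≠ i.1) :
          Function.update σ i true u = false := by
        rwa [Function.update_of_ne (fun h => hui (congrArg Fin.val h))]
      by_cases hsi : s.1 = i.1
      · exact ⟨⟨t, by omega, upd t ht' (by omega)⟩, t, ht, upd t ht' (by omega)⟩
      · by_cases hti : t.1 = i.1
        · exact ⟨⟨s, hs, upd s hs' hsi⟩, s, by omega, upd s hs' hsi⟩
        · exact ⟨⟨s, hs, upd s hs' hsi⟩, t, ht, upd t ht' hti⟩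
    by_cases h : cN = N - 1
    · exact hcone ⟨N - 1, by omega⟩ (by simp only; omega)
    · by_cases h' : c₁ = N - 1
      · exact hcone ⟨0, hN1⟩ (by simp only; omega)
      · exact hcone ⟨c₁ + 1, by omega⟩ (by simp only; omega)
  · intro hN
    exact cohDim_eq_zero_of_cone (hd _ _) ⟨0, hN1⟩ fun σ _ => openOK_of_le hN _

end
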